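/- Let n ≥ 1 and let E ⊂ ℝⁿ be measurable. Suppose there exist x* ∈ ℝⁿ, r* > 0 and ℓ ∈ ℝ such that lim_{s→0⁺} s · Λ_E(x*, r*, s) = ℓ. Then for every x ∈ ℝⁿ and every r > 0, lim_{s→0⁺} s · Λ_E(x, r, s) = ℓ, and moreover ℓ ∈ [0,1]. -/

import Mathlib

open MeasureTheory Real Filter Topology Set
open scoped ENNReal

/-- The classical heat kernel on `ℝⁿ`. -/
noncomputable def heatKernel (n : ℕ) (t : ℝ) (x y : EuclideanSpace ℝ (Fin n)) : ℝ :=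
  (4 * π * t) ^ (-(n : ℝ) / 2) * Real.exp (-‖x - y‖ ^ 2 / (4 * t))

/-- `Λ_E(x,r,s) = ∫₁^∞ t^{-(1+s)} ∫_{E \ B(x,r)} p_t(x,y) dy dt`. -/
noncomputable def LambdaE (n : ℕ) (E : Set (EuclideanSpace ℝ (Fin n)))
    (x : EuclideanSpace ℝ (Fin n)) (r s : ℝ) : ℝ≥0∞ :=
  ∫⁻ t in Set.Ioi (1:ℝ), ENNReal.ofReal (t ^ (-(1 + s))) *
    ∫⁻ y in E \ Metric.ball x r, ENNReal.ofReal (heatKernel n t x y)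

lemma heatKernel_nonneg (n : ℕ) {t : ℝ} (ht : 0 < t) (x y : EuclideanSpace ℝ (Fin n)) :
    0 ≤ heatKernel n t x y := by
  unfold heatKernel; positivity

lemma continuous_heatKernel (n : ℕ) (t : ℝ) (x : EuclideanSpace ℝ (Fin n)) :
    Continuous (heatKernel n t x) := by
  unfold heatKernel; fun_prop

lemma lintegral_heatKernel (n : ℕ) {t : ℝ} (ht : 0 < t) (x : EuclideanSpace ℝ (Fin n)) :
    ∫⁻ y, ENNReal.ofReal (heatKernel n t x y) = 1 := by
  have hb : 0 < 1 / (4 * t) := by positivity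
  have hI := GaussianFourier.integral_rexp_neg_mul_sq_norm
    (V := EuclideanSpace ℝ (Fin n)) hb
  have hpos : 0 < (π / (1 / (4 * t))) ^ (Module.finrank ℝ (EuclideanSpace ℝ (Fin n)) / 2 : ℝ) := by
    positivity
  have hint : Integrable
      (fun v : EuclideanSpace ℝ (Fin n) => Real.exp (-(1 / (4 * t)) * ‖v‖ ^ 2)) := by
    by_contra h
    rw [integral_undef h] at hI
    exact hpos.ne hI
  have hmass : (4 * π * t) ^ (-(n : ℝ) / 2) *
      ∫ v : EuclideanSpace ℝ (Fin n), Real.exp (-(1 / (4 * t)) * ‖v‖ ^ 2) = 1 := by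
    rw [hI, finrank_euclideanSpace_fin, show π / (1 / (4 * t)) = 4 * π * t by field_simp,
      ← Real.rpow_add (by positivity)]
    ring_nf
    simp
  calc ∫⁻ y, ENNReal.ofReal (heatKernel n t x y)
      = ∫⁻ y, (fun v : EuclideanSpace ℝ (Fin n) => ENNReal.ofReal
          ((4 * π * t) ^ (-(n : ℝ) / 2) * Real.exp (-(1 / (4 * t)) * ‖v‖ ^ 2))) (x - y) := by
        refine lintegral_congr fun y => ?_
        simp only [heatKernel]
        congr 3
        ring
    _ = ∫⁻ v : EuclideanSpace ℝ (Fin n), ENNReal.ofReal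
          ((4 * π * t) ^ (-(n : ℝ) / 2) * Real.exp (-(1 / (4 * t)) * ‖v‖ ^ 2)) :=
        lintegral_sub_left_eq_self (μ := volume) (fun v : EuclideanSpace ℝ (Fin n) =>
          ENNReal.ofReal
            ((4 * π * t) ^ (-(n : ℝ) / 2) * Real.exp (-(1 / (4 * t)) * ‖v‖ ^ 2))) x
    _ = 1 := by
        rw [← ofReal_integral_eq_lintegral_ofReal (hint.const_mul _)
          (Eventually.of_forall fun v => by positivity), integral_const_mul, hmass,
          ENNReal.ofReal_one]

lemma exp_neg_sq_div_four_le {u v c : ℝ} (hv : 0 ≤ v) (hc : 0 ≤ c)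
    (h : v ≤ u + c) :
    Real.exp (-u ^ 2 / 4) ≤ Real.exp (-v ^ 2 / 4) + (c + c ^ 2) * Real.exp (-u ^ 2 / 8) := by
  have hE8 := Real.exp_pos (-u ^ 2 / 8)
  have hhalf : Real.exp (-u ^ 2 / 4) = Real.exp (-u ^ 2 / 8) * Real.exp (-u ^ 2 / 8) := by
    rw [← Real.exp_add]; ring_nf
  have hdiff : Real.exp (-u ^ 2 / 4) ≤
      Real.exp (-v ^ 2 / 4) + (c * (u / 2) + c ^ 2 / 4) * Real.exp (-u ^ 2 / 4) := by
    have hsq : v ^ 2 ≤ (u + c) ^ 2 := by gcongr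
    have hexp := Real.add_one_le_exp (-(v ^ 2 - u ^ 2) / 4)
    have hge : 1 - (c * (u / 2) + c ^ 2 / 4) ≤ Real.exp (-(v ^ 2 - u ^ 2) / 4) := by nlinarith
    have hprod : Real.exp (-v ^ 2 / 4) =
        Real.exp (-u ^ 2 / 4) * Real.exp (-(v ^ 2 - u ^ 2) / 4) := by
      rw [← Real.exp_add]; ring_nf
    have := mul_le_mul_of_nonneg_left hge (Real.exp_pos (-u ^ 2 / 4)).le
    rw [hprod]
    linarith
  have hlin : u / 2 * Real.exp (-u ^ 2 / 8) ≤ 1 := by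
    have h1 := Real.add_one_le_exp (u ^ 2 / 8)
    have h2 : u / 2 ≤ Real.exp (u ^ 2 / 8) := by nlinarith [sq_nonneg (u - 2)]
    calc _ ≤ Real.exp (u ^ 2 / 8) * Real.exp (-u ^ 2 / 8) := by gcongr
      _ = 1 := by rw [← Real.exp_add, neg_div, add_neg_cancel, Real.exp_zero]
  have hle1 : Real.exp (-u ^ 2 / 8) ≤ 1 := Real.exp_le_one_iff.2 (by nlinarith [sq_nonneg u])
  have hcoef : (c * (u / 2) + c ^ 2 / 4) * Real.exp (-u ^ 2 / 8) ≤ c + c ^ 2 := by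
    have h1 := mul_le_mul_of_nonneg_left hlin hc
    have h2 := mul_le_mul_of_nonneg_left hle1 (sq_nonneg c)
    nlinarith [sq_nonneg c]
  calc _ ≤ _ := hdiff
    _ = Real.exp (-v ^ 2 / 4) + ((c * (u / 2) + c ^ 2 / 4) * Real.exp (-u ^ 2 / 8)) *
        Real.exp (-u ^ 2 / 8) := by rw [hhalf]; ring
    _ ≤ _ := by gcongr

/-- The heat kernel is Lipschitz in its pole, up to doubling the time in the error term. -/
lemma heatKernel_le_add (n : ℕ) {t : ℝ} (ht : 1 < t) (x x' y : EuclideanSpace ℝ (Fin n)) :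
    heatKernel n t x y ≤ heatKernel n t x' y +
      2 ^ ((n : ℝ) / 2) * (‖x - x'‖ + ‖x - x'‖ ^ 2) * t ^ (-(1 / 2) : ℝ) *
        heatKernel n (2 * t) x y := by
  have h0 : 0 < t := by linarith
  have hsplit : (4 * π * (2 * t)) ^ (-(n : ℝ) / 2) =
      (2 ^ ((n : ℝ) / 2))⁻¹ * (4 * π * t) ^ (-(n : ℝ) / 2) := by
    rw [show 4 * π * (2 * t) = 2 * (4 * π * t) by ring,
      Real.mul_rpow (by positivity) (by positivity), neg_div, Real.rpow_neg (by positivity)]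
  set w : ℝ := t ^ (-(1 / 2) : ℝ) with hw
  have hw0 : 0 < w := by positivity
  have hww : w ^ 2 = 1 / t := by
    rw [hw, ← Real.rpow_natCast, ← Real.rpow_mul h0.le, one_div t, ← Real.rpow_neg_one]
    norm_num
  have hw1 : w ≤ 1 := Real.rpow_le_one_of_one_le_of_nonpos ht.le (by norm_num)
  set d := ‖x - x'‖ with hd
  set ρ := ‖x - y‖ with hρ
  set ρ' := ‖x' - y‖ with hρ'
  have hd0 : 0 ≤ d := norm_nonneg _
  have hρ0 : 0 ≤ ρ := norm_nonneg _
  have htri : ρ' ≤ ρ + d := by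
    have : x' - y = (x - y) - (x - x') := by abel
    rw [hρ', this]
    exact norm_sub_le _ _
  have e1 : -ρ ^ 2 / (4 * t) = -(ρ * w) ^ 2 / 4 := by rw [mul_pow, hww]; field_simp
  have e2 : -ρ' ^ 2 / (4 * t) = -(ρ' * w) ^ 2 / 4 := by rw [mul_pow, hww]; field_simp
  have e3 : -ρ ^ 2 / (4 * (2 * t)) = -(ρ * w) ^ 2 / 8 := by
    rw [mul_pow, hww]; field_simp; ring
  set u := ρ * w with hu
  have hmain : Real.exp (-u ^ 2 / 4) ≤ Real.exp (-(ρ' * w) ^ 2 / 4) +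
      (d + d ^ 2) * w * Real.exp (-u ^ 2 / 8) := by
    have hc := exp_neg_sq_div_four_le (u := u) (by positivity : 0 ≤ ρ' * w)
      (by positivity : 0 ≤ d * w) (by rw [hu, ← add_mul]; gcongr)
    have h2 : d * w + (d * w) ^ 2 ≤ (d + d ^ 2) * w := by
      have h3 : d ^ 2 * w ^ 2 ≤ d ^ 2 * w := by gcongr; nlinarith
      linarith
    exact hc.trans (by gcongr)
  unfold heatKernel
  rw [← hρ, ← hρ', e1, e2, e3, hsplit]
  have hc : (0 : ℝ) < 2 ^ ((n : ℝ) / 2) := by positivity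
  calc _ ≤ (4 * π * t) ^ (-(n : ℝ) / 2) * (Real.exp (-(ρ' * w) ^ 2 / 4) +
      (d + d ^ 2) * w * Real.exp (-u ^ 2 / 8)) := by gcongr
    _ = _ := by field_simp

lemma heatKernel_le_rpow {n : ℕ} (hn : 1 ≤ n) {t : ℝ} (ht : 1 < t)
    (x y : EuclideanSpace ℝ (Fin n)) : heatKernel n t x y ≤ t ^ (-(1 / 2) : ℝ) := by
  have h0 : 0 < t := by linarith
  have hn' : (1 : ℝ) ≤ n := by exact_mod_cast hn
  have hπ := Real.pi_gt_three
  have h4 : t ≤ 4 * π * t := by nlinarith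
  calc heatKernel n t x y ≤ (4 * π * t) ^ (-(n : ℝ) / 2) * 1 := by
        unfold heatKernel
        gcongr
        rw [Real.exp_le_one_iff, neg_div, neg_nonpos]
        positivity
    _ ≤ (4 * π * t) ^ (-(1 / 2) : ℝ) := by
        rw [mul_one]
        exact Real.rpow_le_rpow_of_exponent_le (by linarith) (by linarith)
    _ ≤ _ := Real.rpow_le_rpow_of_nonpos h0 h4 (by norm_num)

lemma exists_setLIntegral_heatKernel_le {n : ℕ} (hn : 1 ≤ n)
    (E : Set (EuclideanSpace ℝ (Fin n))) (x x' : EuclideanSpace ℝ (Fin n)) (r r' : ℝ) :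
    ∃ C : ℝ≥0∞, C ≠ ⊤ ∧ ∀ t : ℝ, 1 < t →
      ∫⁻ y in E \ Metric.ball x r, ENNReal.ofReal (heatKernel n t x y) ≤
        (∫⁻ y in E \ Metric.ball x' r', ENNReal.ofReal (heatKernel n t x' y)) +
          C * ENNReal.ofReal (t ^ (-(1 / 2) : ℝ)) := by
  set K : ℝ := 2 ^ ((n : ℝ) / 2) * (‖x - x'‖ + ‖x - x'‖ ^ 2) with hK
  have hK0 : 0 ≤ K := by positivity
  refine ⟨volume (Metric.ball x' r') + ENNReal.ofReal K,
    ENNReal.add_ne_top.2 ⟨measure_ball_lt_top.ne, ENNReal.ofReal_ne_top⟩, fun t ht => ?_⟩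
  have h0 : 0 < t := by linarith
  have hw0 : 0 ≤ t ^ (-(1 / 2) : ℝ) := by positivity
  have hmeas : Measurable fun y => ENNReal.ofReal (heatKernel n (2 * t) x y) :=
    (continuous_heatKernel n (2 * t) x).measurable.ennreal_ofReal
  calc ∫⁻ y in E \ Metric.ball x r, ENNReal.ofReal (heatKernel n t x y)
      ≤ ∫⁻ y in E, ENNReal.ofReal (heatKernel n t x y) := lintegral_mono_set sdiff_subset
    _ ≤ ∫⁻ y in E, (ENNReal.ofReal (heatKernel n t x' y) +
          ENNReal.ofReal (K * t ^ (-(1 / 2) : ℝ)) *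
            ENNReal.ofReal (heatKernel n (2 * t) x y)) := by
        refine lintegral_mono fun y => ?_
        rw [← ENNReal.ofReal_mul (by positivity), ← ENNReal.ofReal_add
          (heatKernel_nonneg n h0 _ _)
          (mul_nonneg (by positivity) (heatKernel_nonneg n (by positivity) _ _))]
        exact ENNReal.ofReal_le_ofReal (heatKernel_le_add n ht x x' y)
    _ = (∫⁻ y in E, ENNReal.ofReal (heatKernel n t x' y)) +
          ENNReal.ofReal (K * t ^ (-(1 / 2) : ℝ)) *
            ∫⁻ y in E, ENNReal.ofReal (heatKernel n (2 * t) x y) := by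
        rw [lintegral_add_right _ (hmeas.const_mul _), lintegral_const_mul _ hmeas]
    _ ≤ ((∫⁻ y in E \ Metric.ball x' r', ENNReal.ofReal (heatKernel n t x' y)) +
          ∫⁻ y in Metric.ball x' r', ENNReal.ofReal (heatKernel n t x' y)) +
          ENNReal.ofReal (K * t ^ (-(1 / 2) : ℝ)) * 1 := by
        gcongr
        · refine (lintegral_mono_set ?_).trans (lintegral_union_le _ _ _)
          rw [sdiff_union_self]
          exact subset_union_left
        · exact (setLIntegral_le_lintegral _ _).trans
            (lintegral_heatKernel n (by positivity) x).le
    _ ≤ ((∫⁻ y in E \ Metric.ball x' r', ENNReal.ofReal (heatKernel n t x' y)) +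
          ∫⁻ _ in Metric.ball x' r', ENNReal.ofReal (t ^ (-(1 / 2) : ℝ))) +
          ENNReal.ofReal (K * t ^ (-(1 / 2) : ℝ)) * 1 := by
        gcongr with y
        exact heatKernel_le_rpow hn ht x' y
    _ = _ := by
        rw [setLIntegral_const, ENNReal.ofReal_mul hK0]
        ring

lemma lintegral_Ioi_one_rpow {a : ℝ} (ha : 0 < a) :
    ∫⁻ t in Set.Ioi (1 : ℝ), ENNReal.ofReal (t ^ (-(1 + a))) = ENNReal.ofReal (1 / a) := by
  rw [← ofReal_integral_eq_lintegral_ofReal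
    (integrableOn_Ioi_rpow_of_lt (by linarith) one_pos), integral_Ioi_rpow_of_lt (by linarith)
    one_pos]
  · congr 1
    rw [Real.one_rpow, show -(1 + a) + 1 = -a by ring, neg_div_neg_eq]
  · filter_upwards [ae_restrict_mem measurableSet_Ioi] with t ht
    exact Real.rpow_nonneg (zero_le_one.trans (le_of_lt ht)) _

lemma exists_LambdaE_le_add {n : ℕ} (hn : 1 ≤ n)
    (E : Set (EuclideanSpace ℝ (Fin n))) (x x' : EuclideanSpace ℝ (Fin n)) (r r' : ℝ) :
    ∃ C : ℝ≥0∞, C ≠ ⊤ ∧ ∀ s : ℝ, 0 < s → LambdaE n E x r s ≤ LambdaE n E x' r' s + C := by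
  obtain ⟨C, hC, h⟩ := exists_setLIntegral_heatKernel_le hn E x x' r r'
  refine ⟨C * ENNReal.ofReal (1 / (1 / 2)), ENNReal.mul_ne_top hC ENNReal.ofReal_ne_top,
    fun s hs => ?_⟩
  have hm : Measurable fun t : ℝ => ENNReal.ofReal (t ^ (-(1 + 1 / 2) : ℝ)) := by fun_prop
  rw [← lintegral_Ioi_one_rpow (by norm_num : (0 : ℝ) < 1 / 2), ← lintegral_const_mul _ hm]
  unfold LambdaE
  rw [← lintegral_add_right _ (hm.const_mul _)]
  refine setLIntegral_mono' measurableSet_Ioi fun t ht => ?_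
  have ht1 : 1 < t := ht
  have h0 : 0 < t := by linarith
  refine (mul_le_mul_right (h t ht1) _).trans ?_
  rw [mul_add, mul_left_comm, ← ENNReal.ofReal_mul (by positivity), ← Real.rpow_add h0]
  gcongr
  · exact ht1.le
  · linarith

lemma ofReal_mul_LambdaE_le_one (n : ℕ) (E : Set (EuclideanSpace ℝ (Fin n)))
    (x : EuclideanSpace ℝ (Fin n)) (r : ℝ) {s : ℝ} (hs : 0 < s) :
    ENNReal.ofReal s * LambdaE n E x r s ≤ 1 := by
  calc ENNReal.ofReal s * LambdaE n E x r s
      ≤ ENNReal.ofReal s * ∫⁻ t in Set.Ioi (1 : ℝ), ENNReal.ofReal (t ^ (-(1 + s))) := by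
        unfold LambdaE
        gcongr 1
        refine setLIntegral_mono' measurableSet_Ioi fun t ht => ?_
        refine mul_le_of_le_one_right' ((setLIntegral_le_lintegral _ _).trans
          (lintegral_heatKernel n (one_pos.trans ht) x).le)
    _ = 1 := by
        rw [lintegral_Ioi_one_rpow hs, ← ENNReal.ofReal_mul hs.le, mul_one_div_cancel hs.ne',
          ENNReal.ofReal_one]

/-- if `lim_{s→0⁺} s Λ_E(x*,r*,s) = ℓ` for some `x* ∈ ℝⁿ`, `r* > 0`, then the
same limit `ℓ` holds for every `x ∈ ℝⁿ` and `r > 0`, and `ℓ ∈ [0,1]`. -/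
theorem statement12 (n : ℕ) (hn : 1 ≤ n) (E : Set (EuclideanSpace ℝ (Fin n)))
    (hE : MeasurableSet E) (xs : EuclideanSpace ℝ (Fin n)) (rs : ℝ) (hrs : 0 < rs)
    (ℓ : ℝ≥0∞)
    (hlim : Tendsto (fun s : ℝ => ENNReal.ofReal s * LambdaE n E xs rs s)
      (𝓝[>] (0:ℝ)) (𝓝 ℓ)) :
    (∀ x : EuclideanSpace ℝ (Fin n), ∀ r : ℝ, 0 < r →
        Tendsto (fun s : ℝ => ENNReal.ofReal s * LambdaE n E x r s) (𝓝[>] (0:ℝ)) (𝓝 ℓ)) ∧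
      ℓ ≤ 1 := by
  refine ⟨fun x r _ => ?_, le_of_tendsto hlim ?_⟩
  · obtain ⟨C, hC, hupper⟩ := exists_LambdaE_le_add hn E x xs r rs
    obtain ⟨C', hC', hlower⟩ := exists_LambdaE_le_add hn E xs x rs r
    have hsmall : ∀ D : ℝ≥0∞, D ≠ ⊤ →
        Tendsto (fun s : ℝ => ENNReal.ofReal s * D) (𝓝[>] (0:ℝ)) (𝓝 0) := fun D hD => by
      have h := ENNReal.Tendsto.mul_const (b := D)
        ((ENNReal.tendsto_ofReal (tendsto_id (x := 𝓝 (0:ℝ)))).mono_left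
          (nhdsWithin_le_nhds (s := Ioi 0))) (Or.inr hD)
      simpa using h
    have hle := hlim.add (hsmall C hC)
    have hge := ENNReal.Tendsto.sub hlim (hsmall C' hC') (Or.inr ENNReal.zero_ne_top)
    rw [add_zero] at hle
    rw [tsub_zero] at hge
    refine tendsto_of_tendsto_of_tendsto_of_le_of_le' hge hle ?_ ?_
    · filter_upwards [self_mem_nhdsWithin] with s hs
      rw [tsub_le_iff_right, ← mul_add]
      gcongr
      exact hlower s hs
    · filter_upwards [self_mem_nhdsWithin] with s hs
      rw [← mul_add]
      gcongr
      exact hupper s hs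
  · filter_upwards [self_mem_nhdsWithin] with s hs
    exact ofReal_mul_LambdaE_le_one n E xs rs hs
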